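/- arXiv:2406.05212 — 3 statements merged into one kernel-verified Lean document; each statement's English description precedes it below -/
import Mathlib

section
/- Let X be a random variable with X ≥ 0 almost surely, let λ ∈ ℂ with Re(λ) > 0, and let j ≥ 1 be an integer. Let μ_j denote the Gamma(j, Re(λ)) measure and μ_{j-1} the Gamma(j-1, Re(λ)) measure (with μ_0 the Dirac measure at 0). Then (1/(j-1)!) · |E[(-X)^{j-1} e^{-λX}]| ≤ Re(λ)^{1-j} · max( E[ μ_j( (X,∞) ) ], E[ μ_{j-1}( (X,∞) ) ] ), where E[ μ_k( (X,∞) ) ] denotes the expectation over X of the μ_k-measure of the open interval (X(ω), ∞). -/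
open MeasureTheory ProbabilityTheory

/-- The Erlang (Gamma with integer shape) measure: `Gamma(k, s)` for `k ≥ 1`, and the
Dirac measure at `0` for `k = 0`. -/
noncomputable def erlangMeasure (k : ℕ) (s : ℝ) : Measure ℝ :=
  if k = 0 then Measure.dirac 0 else gammaMeasure k s

lemma isProbabilityMeasure_erlangMeasure (k : ℕ) {s : ℝ} (hs : 0 < s) :
    IsProbabilityMeasure (erlangMeasure k s) := by
  unfold erlangMeasure
  split_ifs with hk
  · infer_instance
  · exact isProbabilityMeasure_gammaMeasure (by positivity) hs

/-- The tail of an Erlang distribution of shape `n + 1` dominates the Poisson mass at `n`. -/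
lemma poisson_mass_le_erlangMeasure_Ioi (n : ℕ) {s x : ℝ} (hs : 0 < s) (hx : 0 ≤ x) :
    (s * x) ^ n / n.factorial * Real.exp (-(s * x)) ≤
      (erlangMeasure (n + 1) s (Set.Ioi x)).toReal := by
  have := isProbabilityMeasure_erlangMeasure (n + 1) hs
  rw [← ENNReal.ofReal_le_iff_le_toReal (measure_ne_top _ _)]
  have hint : IntegrableOn (fun t ↦ (s * x) ^ n / n.factorial * s * Real.exp (-s * t))
      (Set.Ioi x) := (integrableOn_exp_mul_Ioi (neg_lt_zero.2 hs) x).const_mul _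
  have hval : ∫ t in Set.Ioi x, (s * x) ^ n / n.factorial * s * Real.exp (-s * t) =
      (s * x) ^ n / n.factorial * Real.exp (-(s * x)) := by
    rw [integral_const_mul, integral_exp_mul_Ioi (neg_lt_zero.2 hs)]
    field_simp
  rw [← hval, ofReal_integral_eq_lintegral_ofReal hint (ae_of_all _ fun t ↦ by positivity),
    erlangMeasure, if_neg n.succ_ne_zero, gammaMeasure, withDensity_apply _ measurableSet_Ioi]
  refine setLIntegral_mono' measurableSet_Ioi fun t ht ↦ ?_
  have ht0 : 0 ≤ t := hx.trans ht.le
  rw [gammaPDF_of_nonneg ht0]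
  refine ENNReal.ofReal_le_ofReal ?_
  have hpow : x ^ n ≤ t ^ n := pow_le_pow_left₀ hx ht.le n
  calc (s * x) ^ n / n.factorial * s * Real.exp (-s * t)
      = s ^ (n + 1) / n.factorial * x ^ n * Real.exp (-(s * t)) := by
        rw [neg_mul]; ring
    _ ≤ s ^ (n + 1) / n.factorial * t ^ n * Real.exp (-(s * t)) := by gcongr
    _ = _ := by
        push_cast
        rw [Real.Gamma_nat_eq_factorial, add_sub_cancel_right, Real.rpow_natCast,
          ← Nat.cast_succ, Real.rpow_natCast]

lemma integrable_erlangMeasure_Ioi {Ω : Type*} [MeasurableSpace Ω] {P : Measure Ω}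
    [IsFiniteMeasure P] {X : Ω → ℝ} (hX : Measurable X) (k : ℕ) {s : ℝ} (hs : 0 < s) :
    Integrable (fun ω ↦ (erlangMeasure k s (Set.Ioi (X ω))).toReal) P := by
  have := isProbabilityMeasure_erlangMeasure k hs
  have hanti : Antitone fun x ↦ (erlangMeasure k s (Set.Ioi x)).toReal := fun a b hab ↦
    ENNReal.toReal_mono (measure_ne_top _ _) (measure_mono (Set.Ioi_subset_Ioi hab))
  refine Integrable.of_bound (hanti.measurable.comp hX).aestronglyMeasurable 1
    (ae_of_all _ fun ω ↦ ?_)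
  rw [Real.norm_of_nonneg ENNReal.toReal_nonneg]
  exact measureReal_le_one

theorem matrix_laplace_entry_erlang_bound {Ω : Type*} [MeasureSpace Ω]
    [IsProbabilityMeasure (ℙ : Measure Ω)] (X : Ω → ℝ) (hX : Measurable X)
    (hX0 : ∀ᵐ ω, 0 ≤ X ω) (lam : ℂ) (hlam : 0 < lam.re) (j : ℕ) (hj : 1 ≤ j) :
    (1 / (Nat.factorial (j - 1) : ℝ)) *
        ‖∫ ω, (-(X ω : ℂ)) ^ (j - 1) * Complex.exp (-(lam * X ω))‖ ≤
      lam.re ^ (1 - (j : ℤ)) *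
        max (∫ ω, (erlangMeasure j lam.re (Set.Ioi (X ω))).toReal)
          (∫ ω, (erlangMeasure (j - 1) lam.re (Set.Ioi (X ω))).toReal) := by
  obtain ⟨n, rfl⟩ : ∃ n, j = n + 1 := ⟨j - 1, by lia⟩
  rw [add_tsub_cancel_right]
  have hexp : lam.re ^ (1 - ((n + 1 : ℕ) : ℤ)) = (lam.re ^ n)⁻¹ := by
    rw [show 1 - ((n + 1 : ℕ) : ℤ) = -(n : ℤ) by push_cast; ring, zpow_neg, zpow_natCast]
  have hpow : 0 < lam.re ^ n := pow_pos hlam n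
  have hbound : ‖∫ ω, (-(X ω : ℂ)) ^ n * Complex.exp (-(lam * X ω))‖ ≤
      ∫ ω, n.factorial * (lam.re ^ n)⁻¹ *
        (erlangMeasure (n + 1) lam.re (Set.Ioi (X ω))).toReal := by
    refine norm_integral_le_of_norm_le
      ((integrable_erlangMeasure_Ioi hX (n + 1) hlam).const_mul _) ?_
    filter_upwards [hX0] with ω hω
    have hnorm : ‖(-(X ω : ℂ)) ^ n * Complex.exp (-(lam * X ω))‖ =
        X ω ^ n * Real.exp (-(lam.re * X ω)) := by
      simp [Complex.norm_exp, abs_of_nonneg hω]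
    calc ‖(-(X ω : ℂ)) ^ n * Complex.exp (-(lam * X ω))‖
        = n.factorial * (lam.re ^ n)⁻¹ *
          ((lam.re * X ω) ^ n / n.factorial * Real.exp (-(lam.re * X ω))) := by
          rw [hnorm, mul_pow]
          field_simp
      _ ≤ _ := by
          gcongr
          exact poisson_mass_le_erlangMeasure_Ioi n hlam hω
  rw [integral_const_mul] at hbound
  rw [hexp]
  calc _ ≤ 1 / (n.factorial : ℝ) * (n.factorial * (lam.re ^ n)⁻¹ *
        ∫ ω, (erlangMeasure (n + 1) lam.re (Set.Ioi (X ω))).toReal) := by gcongr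
    _ = (lam.re ^ n)⁻¹ * ∫ ω, (erlangMeasure (n + 1) lam.re (Set.Ioi (X ω))).toReal := by
        field_simp
    _ ≤ _ := by
        gcongr
        exact le_max_left _ _
end

section
/- Let X and Z be nonnegative real random variables on a probability space that are independent, let τ > 0, and let μ denote the law of Z. For θ ≥ 0 define M₊(θ) = ∫ e^{θz} dμ(z) ∈ [0,∞] and M₋(θ) = ∫ e^{-θz} dμ(z). Then |P(X ≥ τ) − P(X ≥ τ Z)| ≤ max( ∫_{\{X ≥ τ\}} inf_{θ ≥ 0} ( M₊(θ) · e^{-θ X/τ} ) dP, ∫_{\{X < τ\}} inf_{θ ≥ 0} ( M₋(θ) · e^{θ X/τ} ) dP ), where the integrals and infima are taken in the extended nonnegative reals [0,∞]. -/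
open MeasureTheory ProbabilityTheory

theorem ProbabilityTheory.IndepFun.measure_inter_preimage_le_setLIntegral
    {Ω α β : Type*} [MeasurableSpace Ω] [MeasurableSpace α] [MeasurableSpace β]
    {P : Measure Ω} [IsFiniteMeasure P] {X : Ω → α} {Z : Ω → β}
    (hindep : IndepFun X Z P) (hX : Measurable X) (hZ : Measurable Z)
    {S : Set α} (hS : MeasurableSet S) {T : Set (α × β)} (hT : MeasurableSet T)
    {f : Ω → ENNReal} (hf : ∀ ω, P.map Z (Prod.mk (X ω) ⁻¹' T) ≤ f ω) :
    P {ω | X ω ∈ S ∧ (X ω, Z ω) ∈ T} ≤ ∫⁻ ω in X ⁻¹' S, f ω ∂P := by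
  have hU : MeasurableSet (Prod.fst ⁻¹' S ∩ T) := (measurable_fst hS).inter hT
  have hmap := (indepFun_iff_map_prod_eq_prod_map_map hX.aemeasurable hZ.aemeasurable).1 hindep
  calc P {ω | X ω ∈ S ∧ (X ω, Z ω) ∈ T}
      = P.map (fun ω => (X ω, Z ω)) (Prod.fst ⁻¹' S ∩ T) := by
        rw [Measure.map_apply (hX.prodMk hZ) hU]; rfl
    _ = ∫⁻ ω, P.map Z (Prod.mk (X ω) ⁻¹' (Prod.fst ⁻¹' S ∩ T)) ∂P := by
        rw [hmap, Measure.prod_apply hU, lintegral_map (measurable_measure_prodMk_left hU) hX]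
    _ ≤ ∫⁻ ω, (X ⁻¹' S).indicator f ω ∂P := by
        refine lintegral_mono fun ω => ?_
        by_cases h : X ω ∈ S
        · rw [Set.indicator_of_mem (show ω ∈ X ⁻¹' S from h)]
          exact (measure_mono fun z hz => hz.2).trans (hf ω)
        · have hempty : Prod.mk (X ω) ⁻¹' (Prod.fst ⁻¹' S ∩ T) = (∅ : Set β) :=
            Set.eq_empty_of_forall_notMem fun z hz => h hz.1
          simp [hempty]
    _ = ∫⁻ ω in X ⁻¹' S, f ω ∂P := lintegral_indicator (hX hS) f

theorem measure_le_lintegral_ofReal_exp_mul {β : Type*} [MeasurableSpace β] (μ : Measure β)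
    {s : Set β} (hs : MeasurableSet s) {g : β → ℝ} {c : ℝ}
    (h : ∀ z ∈ s, 0 ≤ g z + c) :
    μ s ≤ (∫⁻ z, ENNReal.ofReal (Real.exp (g z)) ∂μ) * ENNReal.ofReal (Real.exp c) := by
  rw [← lintegral_mul_const' _ _ ENNReal.ofReal_ne_top, ← lintegral_indicator_one hs]
  refine lintegral_mono (Set.indicator_le fun z hz => ?_)
  rw [← ENNReal.ofReal_mul (Real.exp_nonneg _), ← Real.exp_add, Pi.one_apply,
    ENNReal.one_le_ofReal]
  exact Real.one_le_exp (h z hz)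

theorem ofReal_abs_measure_sub_le_max {Ω : Type*} [MeasurableSpace Ω] (P : Measure Ω)
    [IsFiniteMeasure P] {A B : Set Ω} (hA : MeasurableSet A) (hB : MeasurableSet B) :
    ENNReal.ofReal |(P A).toReal - (P B).toReal| ≤ max (P (A \ B)) (P (B \ A)) := by
  have h₁ : P.real A - P.real B = P.real (A \ B) - P.real (B \ A) := by
    have hAB := measureReal_inter_add_sdiff (μ := P) (s := A) hB
    have hBA := measureReal_inter_add_sdiff (μ := P) (s := B) hA
    rw [Set.inter_comm] at hBA
    linarith
  change ENNReal.ofReal |P.real A - P.real B| ≤ _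
  rw [h₁, ← ofReal_measureReal (μ := P) (s := A \ B), ← ofReal_measureReal (μ := P) (s := B \ A),
    ← ENNReal.ofReal_max]
  refine ENNReal.ofReal_le_ofReal (abs_le.2 ⟨?_, ?_⟩)
  · linarith [le_max_right (P.real (A \ B)) (P.real (B \ A)),
      measureReal_nonneg (μ := P) (s := A \ B)]
  · linarith [le_max_left (P.real (A \ B)) (P.real (B \ A)),
      measureReal_nonneg (μ := P) (s := B \ A)]

theorem ccdf_approx_chernoff_bound {Ω : Type*} [MeasureSpace Ω]
    [IsProbabilityMeasure (ℙ : Measure Ω)]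
    (X Z : Ω → ℝ) (hX : Measurable X) (hZ : Measurable Z)
    (hX0 : ∀ᵐ ω, 0 ≤ X ω) (hZ0 : ∀ᵐ ω, 0 ≤ Z ω)
    (hindep : IndepFun X Z ℙ) (τ : ℝ) (hτ : 0 < τ) :
    ENNReal.ofReal |(ℙ {ω | τ ≤ X ω}).toReal - (ℙ {ω | τ * Z ω ≤ X ω}).toReal| ≤
      max
        (∫⁻ ω in {ω | τ ≤ X ω}, ⨅ θ : Set.Ici (0 : ℝ),
          (∫⁻ z, ENNReal.ofReal (Real.exp ((θ : ℝ) * z)) ∂(Measure.map Z ℙ)) *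
            ENNReal.ofReal (Real.exp (-((θ : ℝ) * (X ω / τ)))))
        (∫⁻ ω in {ω | X ω < τ}, ⨅ θ : Set.Ici (0 : ℝ),
          (∫⁻ z, ENNReal.ofReal (Real.exp (-((θ : ℝ) * z))) ∂(Measure.map Z ℙ)) *
            ENNReal.ofReal (Real.exp ((θ : ℝ) * (X ω / τ)))) := by
  refine (ofReal_abs_measure_sub_le_max ℙ (measurableSet_le measurable_const hX)
    (measurableSet_le (hZ.const_mul τ) hX)).trans (max_le_max ?_ ?_)
  · have hT : MeasurableSet {p : ℝ × ℝ | p.1 < τ * p.2} :=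
      measurableSet_lt measurable_fst (measurable_snd.const_mul τ)
    have hset : {ω | τ ≤ X ω} \ {ω | τ * Z ω ≤ X ω} =
        {ω | X ω ∈ Set.Ici τ ∧ (X ω, Z ω) ∈ {p : ℝ × ℝ | p.1 < τ * p.2}} := by
      ext ω; simp
    rw [hset]
    refine hindep.measure_inter_preimage_le_setLIntegral hX hZ measurableSet_Ici hT fun ω =>
      le_iInf fun θ => measure_le_lintegral_ofReal_exp_mul _ (measurable_prodMk_left hT)
        fun z hz => ?_
    have hz' : X ω / τ ≤ z := (div_le_iff₀' hτ).2 (le_of_lt hz)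
    linarith [mul_le_mul_of_nonneg_left hz' θ.2]
  · have hT : MeasurableSet {p : ℝ × ℝ | τ * p.2 ≤ p.1} :=
      measurableSet_le (measurable_snd.const_mul τ) measurable_fst
    have hset : {ω | τ * Z ω ≤ X ω} \ {ω | τ ≤ X ω} =
        {ω | X ω ∈ Set.Iio τ ∧ (X ω, Z ω) ∈ {p : ℝ × ℝ | τ * p.2 ≤ p.1}} := by
      ext ω; simp [and_comm]
    rw [hset]
    refine hindep.measure_inter_preimage_le_setLIntegral hX hZ measurableSet_Iio hT fun ω =>
      le_iInf fun θ => measure_le_lintegral_ofReal_exp_mul _ (measurable_prodMk_left hT)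
        fun z hz => ?_
    have hz' : z ≤ X ω / τ := (le_div_iff₀' hτ).2 hz
    linarith [mul_le_mul_of_nonneg_left hz' θ.2]
end

section
/- Let N ≥ 1 be an integer and let Z be a random variable whose law is Gamma(N, N) (so that E[Z] = 1). Then for every δ > 0, P(Z ≥ 1+δ) ≤ exp( -N (δ − log(1+δ)) ), and for every δ ∈ (0,1), P(Z ≤ 1−δ) ≤ exp( -N (δ − log(1+δ)) ). -/
open MeasureTheory ProbabilityTheory

/-- Exponential tilting of a gamma density with rate `r` gives a multiple of the gamma density with
rate `s`. -/
lemma exp_mul_gammaPDF {a r s : ℝ} (hr : 0 < r) (hs : 0 < s) (x : ℝ) :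
    gammaPDF a r x * ENNReal.ofReal (Real.exp ((r - s) * x)) =
      ENNReal.ofReal ((r / s) ^ a) * gammaPDF a s x := by
  rcases lt_or_ge x 0 with hx | hx
  · simp [gammaPDF_of_neg hx]
  · rw [gammaPDF_of_nonneg hx, gammaPDF_of_nonneg hx, ← ENNReal.ofReal_mul' (Real.exp_pos _).le,
      ← ENNReal.ofReal_mul (by positivity), mul_assoc, ← Real.exp_add,
      Real.div_rpow hr.le hs.le]
    have hsa : s ^ a ≠ 0 := (Real.rpow_pos_of_pos hs a).ne'
    rw [show -(r * x) + (r - s) * x = -(s * x) by ring]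
    congr 1
    field_simp

lemma lintegral_exp_mul_gammaMeasure {a r s : ℝ} (ha : 0 < a) (hr : 0 < r) (hs : 0 < s) :
    ∫⁻ x, ENNReal.ofReal (Real.exp ((r - s) * x)) ∂gammaMeasure a r =
      ENNReal.ofReal ((r / s) ^ a) := by
  have hm (q : ℝ) : Measurable (gammaPDF a q) := (measurable_gammaPDFReal a q).ennreal_ofReal
  rw [gammaMeasure, lintegral_withDensity_eq_lintegral_mul _ (hm r) (by fun_prop)]
  simp_rw [Pi.mul_apply, exp_mul_gammaPDF hr hs]
  rw [lintegral_const_mul _ (hm s), lintegral_gammaPDF_eq_one ha hs, mul_one]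

lemma integrable_exp_mul_gammaMeasure {a r s : ℝ} (ha : 0 < a) (hr : 0 < r) (hs : 0 < s) :
    Integrable (fun x ↦ Real.exp ((r - s) * x)) (gammaMeasure a r) := by
  refine ⟨by fun_prop, ?_⟩
  rw [hasFiniteIntegral_iff_ofReal (ae_of_all _ fun _ ↦ (Real.exp_pos _).le),
    lintegral_exp_mul_gammaMeasure ha hr hs]
  exact ENNReal.ofReal_lt_top

lemma mgf_id_gammaMeasure {a r s : ℝ} (ha : 0 < a) (hr : 0 < r) (hs : 0 < s) :
    mgf id (gammaMeasure a r) (r - s) = (r / s) ^ a := by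
  simp only [mgf, id]
  rw [integral_eq_lintegral_of_nonneg_ae (ae_of_all _ fun _ ↦ (Real.exp_pos _).le) (by fun_prop),
    lintegral_exp_mul_gammaMeasure ha hr hs, ENNReal.toReal_ofReal (by positivity)]

lemma exp_mul_mgf_id_gammaMeasure {a c : ℝ} (ha : 0 < a) (hc : 0 < c) :
    Real.exp (-(a - a / c) * c) * mgf id (gammaMeasure a a) (a - a / c) =
      Real.exp (-(a * (c - 1 - Real.log c))) := by
  rw [mgf_id_gammaMeasure ha ha (div_pos ha hc), div_div_cancel₀ ha.ne', Real.rpow_def_of_pos hc,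
    ← Real.exp_add]
  congr 1
  field_simp
  ring

/-- Chernoff bound for the upper tail of a gamma distribution with mean `1`. -/
lemma gammaMeasure_real_Ici_le {a c : ℝ} (ha : 0 < a) (hc : 1 ≤ c) :
    (gammaMeasure a a).real (Set.Ici c) ≤ Real.exp (-(a * (c - 1 - Real.log c))) := by
  have := isProbabilityMeasure_gammaMeasure ha ha
  have hc0 : 0 < c := by linarith
  rw [← exp_mul_mgf_id_gammaMeasure ha hc0]
  exact measure_ge_le_exp_mul_mgf (X := id) c (sub_nonneg.2 (div_le_self ha.le hc))
    (integrable_exp_mul_gammaMeasure ha ha (div_pos ha hc0))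

/-- Chernoff bound for the lower tail of a gamma distribution with mean `1`. -/
lemma gammaMeasure_real_Iic_le {a c : ℝ} (ha : 0 < a) (hc0 : 0 < c) (hc : c ≤ 1) :
    (gammaMeasure a a).real (Set.Iic c) ≤ Real.exp (-(a * (c - 1 - Real.log c))) := by
  have := isProbabilityMeasure_gammaMeasure ha ha
  rw [← exp_mul_mgf_id_gammaMeasure ha hc0]
  exact measure_le_le_exp_mul_mgf (X := id) c (sub_nonpos.2 (le_div_self ha.le hc0 hc))
    (integrable_exp_mul_gammaMeasure ha ha (div_pos ha hc0))

lemma two_mul_le_log_one_add_sub_log_one_sub {x : ℝ} (hx0 : 0 ≤ x) (hx1 : x < 1) :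
    2 * x ≤ Real.log (1 + x) - Real.log (1 - x) := by
  have h1 : 0 < 1 - x := by linarith
  have h := Real.le_log_one_add_of_nonneg (x := 2 * x / (1 - x)) (by positivity)
  rw [← Real.log_div (by linarith) h1.ne']
  convert h using 1
  · field_simp
    ring
  · congr 1
    field_simp
    ring

theorem erlang_chernoff_tail_bounds {Ω : Type*} [MeasureSpace Ω]
    [IsProbabilityMeasure (ℙ : Measure Ω)]
    (N : ℕ) (hN : 1 ≤ N) (Z : Ω → ℝ) (hZ : Measurable Z)
    (hZlaw : Measure.map Z ℙ = erlangMeasure N N) :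
    (∀ δ : ℝ, 0 < δ →
      (ℙ {ω | 1 + δ ≤ Z ω}).toReal ≤ Real.exp (-(N * (δ - Real.log (1 + δ))))) ∧
    (∀ δ : ℝ, 0 < δ → δ < 1 →
      (ℙ {ω | Z ω ≤ 1 - δ}).toReal ≤ Real.exp (-(N * (δ - Real.log (1 + δ))))) := by
  have hN0 : (0 : ℝ) < N := by exact_mod_cast hN
  have hlaw : Measure.map Z ℙ = gammaMeasure N N := by
    rw [hZlaw, erlangMeasure, if_neg (by lia)]
  have hreal {s : Set ℝ} (hs : MeasurableSet s) :
      (ℙ (Z ⁻¹' s)).toReal = (gammaMeasure N N).real s := by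
    rw [← hlaw, measureReal_def, Measure.map_apply hZ hs]
  refine ⟨fun δ hδ ↦ ?_, fun δ hδ hδ1 ↦ ?_⟩
  · have h := gammaMeasure_real_Ici_le hN0 (c := 1 + δ) (by linarith)
    rw [add_sub_cancel_left] at h
    exact (hreal measurableSet_Ici).trans_le h
  · refine (hreal measurableSet_Iic).trans_le
      ((gammaMeasure_real_Iic_le hN0 (c := 1 - δ) (by linarith) (by linarith)).trans ?_)
    have h := two_mul_le_log_one_add_sub_log_one_sub hδ.le hδ1
    exact Real.exp_le_exp.2 (neg_le_neg (mul_le_mul_of_nonneg_left (by linarith) hN0.le))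
end
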